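/- arXiv:math/9904061 — 2 statements merged into one kernel-verified Lean document; each statement's English description precedes it below -/
import Mathlib

section
/- Kummer's theorem: Let a, b be complex numbers with Re(b) < 1, and suppose 1 + a - b is not a nonpositive integer (so no denominator vanishes) and none of 1 + a/2, 1 + a - b, 1 + a, 1 + a/2 - b is a nonpositive integer. Then the series ∑_{k=0}^∞ (a)_k (b)_k (−1)^k / ((1+a−b)_k · k!) converges and equals Γ(1 + a/2) Γ(1 + a − b) / (Γ(1 + a) Γ(1 + a/2 − b)). -/
open Complex Finset Filter Topology

/-- The Pochhammer symbol `(x)_k = x (x+1) ⋯ (x+k-1)`. -/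
noncomputable def poch (x : ℂ) (k : ℕ) : ℂ := (ascPochhammer ℂ k).eval x

lemma poch_zero (x : ℂ) : poch x 0 = 1 := by simp [poch]

lemma poch_succ (x : ℂ) (k : ℕ) : poch x (k + 1) = poch x k * (x + k) :=
  ascPochhammer_succ_eval k x

lemma poch_succ_left (x : ℂ) (k : ℕ) : poch x (k + 1) = x * poch (x + 1) k := by
  simp [poch, ascPochhammer_succ_left]

lemma poch_eq_prod (x : ℂ) (k : ℕ) : poch x k = ∏ j ∈ range k, (x + j) := by
  induction k with
  | zero => simp [poch_zero]
  | succ k ih => rw [poch_succ, ih, prod_range_succ]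

lemma poch_ne_zero {x : ℂ} (hx : ∀ m : ℕ, x ≠ -(m : ℂ)) (k : ℕ) : poch x k ≠ 0 := by
  rw [poch_eq_prod, prod_ne_zero_iff]
  exact fun j _ h => hx j (eq_neg_of_add_eq_zero_left h)

lemma ne_neg_natCast_add {x : ℂ} (hx : ∀ m : ℕ, x ≠ -(m : ℂ)) (n m : ℕ) :
    x + n ≠ -(m : ℂ) := by
  intro h
  apply hx (n + m)
  push_cast
  linear_combination h

/-- Euler's limit formula, in a form that is also valid at the poles of `Γ`. -/
lemma tendsto_poch_div (z : ℂ) :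
    Tendsto (fun n : ℕ => poch z n / ((Nat.factorial n : ℂ) * (n : ℂ) ^ (z - 1))) atTop
      (𝓝 (Gamma z)⁻¹) := by
  by_cases hz : ∀ m : ℕ, z ≠ -(m : ℂ)
  · have h := ((GammaSeq_tendsto_Gamma z).inv₀ (Gamma_ne_zero hz)).mul
      (tendsto_add_mul_div_add_mul_atTop_nhds (0 : ℂ) z 1 one_ne_zero)
    rw [div_one, mul_one] at h
    refine h.congr' ?_
    filter_upwards [eventually_ne_atTop 0] with n hn
    have hn' : (n : ℂ) ≠ 0 := Nat.cast_ne_zero.mpr hn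
    have hzn : z + n ≠ 0 := fun h => hz n (eq_neg_of_add_eq_zero_left h)
    have hf : (Nat.factorial n : ℂ) ≠ 0 := Nat.cast_ne_zero.mpr n.factorial_ne_zero
    have hp : (n : ℂ) ^ z ≠ 0 := by simp [cpow_eq_zero_iff, hn']
    rw [GammaSeq, ← poch_eq_prod, poch_succ, cpow_sub _ _ hn', cpow_one]
    field_simp
    ring
  · push Not at hz
    obtain ⟨m, rfl⟩ := hz
    rw [Gamma_neg_nat_eq_zero, inv_zero]
    refine tendsto_const_nhds.congr' ?_
    filter_upwards [eventually_gt_atTop m] with n hn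
    rw [poch_eq_prod, prod_eq_zero (mem_range.mpr hn) (by simp), zero_div]

lemma isBigO_poch_mul_poch_div {x y z : ℂ} (hz : ∀ m : ℕ, z ≠ -(m : ℂ)) :
    (fun n : ℕ => poch x n * poch y n / (poch z n * (Nat.factorial n : ℂ))) =O[atTop]
      (fun n : ℕ => (n : ℝ) ^ (x + y - z - 1).re) := by
  have h := ((tendsto_poch_div x).mul (tendsto_poch_div y)).div (tendsto_poch_div z)
    (inv_ne_zero (Gamma_ne_zero hz))
  have h' : Tendsto (fun n : ℕ => poch x n * poch y n / (poch z n * (Nat.factorial n : ℂ)) /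
      (n : ℂ) ^ (x + y - z - 1)) atTop (𝓝 ((Gamma x)⁻¹ * (Gamma y)⁻¹ / (Gamma z)⁻¹)) := by
    refine h.congr' ?_
    filter_upwards [eventually_ne_atTop 0] with n hn
    have hn' : (n : ℂ) ≠ 0 := Nat.cast_ne_zero.mpr hn
    have hf : (Nat.factorial n : ℂ) ≠ 0 := Nat.cast_ne_zero.mpr n.factorial_ne_zero
    have hp (w : ℂ) : (n : ℂ) ^ w ≠ 0 := by simp [cpow_eq_zero_iff, hn']
    have hx := hp x
    have hy := hp y
    have hzz := hp z
    have hzp := poch_ne_zero hz n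
    simp only [Pi.div_apply, cpow_sub _ _ hn', cpow_add _ _ hn', cpow_one]
    field_simp
  have hO := Asymptotics.isBigO_of_div_tendsto_nhds ?_ _ h'
  · refine hO.trans (Asymptotics.IsBigO.of_norm_eventuallyLE ?_)
    filter_upwards [eventually_gt_atTop 0] with n hn
    rw [norm_natCast_cpow_of_pos hn]
  · filter_upwards [eventually_ne_atTop 0] with n hn h0
    exact absurd h0 (by simp [cpow_eq_zero_iff, hn])

lemma tendsto_poch_mul_poch_div_zero {x y z : ℂ} (hz : ∀ m : ℕ, z ≠ -(m : ℂ))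
    (h : (x + y - z - 1).re < 0) :
    Tendsto (fun n : ℕ => poch x n * poch y n / (poch z n * (Nat.factorial n : ℂ)) * (-1) ^ n)
      atTop (𝓝 0) := by
  rw [tendsto_zero_iff_norm_tendsto_zero]
  simp only [norm_mul, norm_pow, norm_neg, norm_one, one_pow, mul_one]
  have h0 : Tendsto (fun n : ℕ => (n : ℝ) ^ (x + y - z - 1).re) atTop (𝓝 0) := by
    have := (tendsto_rpow_neg_atTop (neg_pos.mpr h)).comp (tendsto_natCast_atTop_atTop (R := ℝ))
    simpa [Function.comp_def] using this
  simpa using ((isBigO_poch_mul_poch_div hz).trans_tendsto h0).norm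

lemma summable_norm_poch_mul_poch_div {x y z : ℂ} (hz : ∀ m : ℕ, z ≠ -(m : ℂ))
    (h : (x + y - z - 1).re < -1) :
    Summable (fun n : ℕ => ‖poch x n * poch y n / (poch z n * (Nat.factorial n : ℂ))‖) :=
  summable_of_isBigO_nat (Real.summable_nat_rpow.mpr h) (isBigO_poch_mul_poch_div hz).norm_left

lemma summable_norm_poch_div_factorial {b : ℂ} (hb : b.re < 0) :
    Summable (fun n : ℕ => ‖poch b n / (Nat.factorial n : ℂ)‖) := by
  have h1 (m : ℕ) : (1 : ℂ) ≠ -(m : ℂ) := by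
    intro h
    have : (1 : ℂ) + m = 0 := by rw [h]; ring
    norm_cast at this
    omega
  have h := summable_norm_poch_mul_poch_div (x := b) (y := 1) h1 (by simp; linarith)
  refine h.congr fun n => ?_
  rw [mul_comm, mul_div_mul_left _ _ (poch_ne_zero h1 n)]

lemma ringChoose_add_sub_one (b : ℂ) (n : ℕ) :
    Ring.choose (b + n - 1) n = poch b n / (Nat.factorial n : ℂ) := by
  have hf : (Nat.factorial n : ℂ) ≠ 0 := Nat.cast_ne_zero.mpr n.factorial_ne_zero
  rw [eq_div_iff hf, Ring.choose, poch, ← Polynomial.ascPochhammer_smeval_eq_eval,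
    ← Ring.factorial_nsmul_multichoose_eq_ascPochhammer, nsmul_eq_mul, mul_comm]
  congr 2
  ring

/-- The binomial series at the boundary point `1`. -/
lemma tsum_poch_div_factorial {b : ℂ} (hb : b.re < 0) :
    ∑' n : ℕ, poch b n / (Nat.factorial n : ℂ) * (-1) ^ n = 2 ^ (-b) := by
  have hs : Summable (fun n : ℕ => poch b n / (Nat.factorial n : ℂ) * (-1) ^ n) :=
    .of_norm ((summable_norm_poch_div_factorial hb).congr fun n => by simp)
  have h1 := Complex.tendsto_tsum_powerSeries_nhdsWithin_lt hs.hasSum.tendsto_sum_nat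
  rw [tendsto_map'_iff] at h1
  have h2 : Tendsto (fun t : ℝ => ((1 : ℂ) + t) ^ (-b)) (𝓝[<] 1) (𝓝 (2 ^ (-b))) := by
    have : ContinuousAt (fun t : ℝ => ((1 : ℂ) + t) ^ (-b)) 1 := by
      refine ContinuousAt.cpow (by fun_prop) continuousAt_const ?_
      left
      norm_num
    have h := this.tendsto
    norm_num at h
    exact h.mono_left nhdsWithin_le_nhds
  refine tendsto_nhds_unique h1 (h2.congr' ?_)
  have hmem : Set.Ioo (0 : ℝ) 1 ∈ 𝓝[<] (1 : ℝ) := Ioo_mem_nhdsLT one_pos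
  filter_upwards [hmem] with t ht
  have h := (one_div_one_sub_cpow_hasFPowerSeriesOnBall_zero b).hasSum
    (y := -(t : ℂ)) (by
      rw [Metric.mem_eball, edist_zero_right]
      rw [← ofReal_norm, norm_neg, norm_real, Real.norm_of_nonneg ht.1.le]
      simpa using ht.2)
  simp only [FormalMultilinearSeries.ofScalars_apply_eq, zero_add, ringChoose_add_sub_one,
    sub_neg_eq_add, one_div, ← cpow_neg] at h
  rw [← h.tsum_eq]
  refine tsum_congr fun n => ?_
  rw [smul_eq_mul, neg_pow]
  ring

/-- The general term of Kummer's series. -/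
noncomputable def kummerTerm (a b : ℂ) (k : ℕ) : ℂ :=
  poch a k * poch b k * (-1 : ℂ) ^ k / (poch (1 + a - b) k * (Nat.factorial k : ℂ))

lemma summable_norm_kummerTerm {a b : ℂ} (hb : b.re < 0) (h1 : ∀ m : ℕ, 1 + a - b ≠ -(m : ℂ)) :
    Summable (fun k => ‖kummerTerm a b k‖) := by
  have hre : (a + b - (1 + a - b) - 1).re < -1 := by
    simp only [sub_re, add_re, one_re]
    linarith
  refine (summable_norm_poch_mul_poch_div h1 hre).congr fun k => ?_
  simp [kummerTerm]

/-- Gosper summation for the contiguous relation in `b`. -/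
lemma sum_kummerTerm_sub_one {a b : ℂ} (h1 : ∀ m : ℕ, 1 + a - b ≠ -(m : ℂ)) (N : ℕ) :
    2 * (1 + a - b) * ∑ k ∈ range (N + 1), kummerTerm a b k =
      (2 + a - 2 * b) * ∑ k ∈ range (N + 1), kummerTerm a (b - 1) k +
        a * (poch (a + 1) N * poch b N / (poch (1 + a - b + 1) N * (Nat.factorial N : ℂ))) *
          (-1) ^ N := by
  have hc : 1 + a - b ≠ 0 := by simpa using h1 0
  have h1' : ∀ m : ℕ, 1 + a - b + 1 ≠ -(m : ℂ) := by simpa using ne_neg_natCast_add h1 1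
  have e : 1 + a - (b - 1) = 1 + a - b + 1 := by ring
  induction N with
  | zero =>
    simp [kummerTerm, poch_zero]
    ring
  | succ N ih =>
    rw [sum_range_succ, sum_range_succ _ (N + 1), mul_add, mul_add, ih]
    have hf : (Nat.factorial N : ℂ) ≠ 0 := Nat.cast_ne_zero.mpr N.factorial_ne_zero
    have hN : (N : ℂ) + 1 ≠ 0 := Nat.cast_add_one_ne_zero N
    have hp := poch_ne_zero h1' N
    have hcN : 1 + a - b + 1 + N ≠ 0 := fun h => h1' N (eq_neg_of_add_eq_zero_left h)
    have hbs : poch (b - 1) (N + 1) = (b - 1) * poch b N := by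
      rw [poch_succ_left, sub_add_cancel]
    simp only [kummerTerm, e, hbs]
    rw [poch_succ_left a, poch_succ_left (1 + a - b), poch_succ b, poch_succ (1 + a - b + 1),
      poch_succ (a + 1), Nat.factorial_succ, pow_succ]
    push_cast
    field_simp
    ring

/-- Gosper summation for the contiguous relation in `a`. -/
lemma sum_kummerTerm_add_two {a b : ℂ} (h1 : ∀ m : ℕ, 1 + a - b ≠ -(m : ℂ)) (N : ℕ) :
    (1 + a) * (2 + a - 2 * b) * ∑ k ∈ range (N + 1), kummerTerm (a + 2) b k =
      (1 + a - b) * (1 + a - b + 1) * ∑ k ∈ range (N + 1), kummerTerm a b k +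
        b * (1 - b) * (poch (a + 1) N * poch (b + 1) N /
          (poch (1 + a - b + 2) N * (Nat.factorial N : ℂ))) * (-1) ^ N := by
  have hc : 1 + a - b ≠ 0 := by simpa using h1 0
  have hc1 : 1 + a - b + 1 ≠ 0 := by simpa using ne_neg_natCast_add h1 1 0
  have h1' : ∀ m : ℕ, 1 + a - b + 2 ≠ -(m : ℂ) := by simpa using ne_neg_natCast_add h1 2
  have e : 1 + (a + 2) - b = 1 + a - b + 2 := by ring
  induction N with
  | zero =>
    simp [kummerTerm, poch_zero]
    ring
  | succ N ih =>
    rw [sum_range_succ, sum_range_succ _ (N + 1), mul_add, mul_add, ih]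
    have hf : (Nat.factorial N : ℂ) ≠ 0 := Nat.cast_ne_zero.mpr N.factorial_ne_zero
    have hN : (N : ℂ) + 1 ≠ 0 := Nat.cast_add_one_ne_zero N
    have hp := poch_ne_zero h1' N
    have hcN : 1 + a - b + 2 + N ≠ 0 := fun h => h1' N (eq_neg_of_add_eq_zero_left h)
    have ha2 : (1 + a) * poch (a + 2) (N + 1) =
        poch (a + 1) N * (a + 1 + N) * (a + 2 + N) := by
      have := poch_succ_left (a + 1) (N + 1)
      rw [poch_succ, poch_succ, show a + 1 + 1 = a + 2 by ring] at this
      rw [add_comm 1 a, ← this]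
      push_cast
      ring
    have hcc : poch (1 + a - b) (N + 1) * (1 + a - b + 1 + N) =
        (1 + a - b) * (1 + a - b + 1) * poch (1 + a - b + 2) N := by
      have h := poch_succ_left (1 + a - b) (N + 1)
      rw [poch_succ, poch_succ_left (1 + a - b + 1),
        show 1 + a - b + 1 + 1 = 1 + a - b + 2 by ring] at h
      push_cast at h
      linear_combination h
    have hcN1 : 1 + a - b + 1 + N ≠ 0 := by
      have := ne_neg_natCast_add h1 (N + 1) 0
      push_cast at this
      intro h
      apply this
      linear_combination h
    have hcc' := eq_div_of_mul_eq hcN1 hcc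
    have hk : (1 + a) * (2 + a - 2 * b) * kummerTerm (a + 2) b (N + 1) = (2 + a - 2 * b) *
        (poch (a + 1) N * (a + 1 + N) * (a + 2 + N)) * poch b (N + 1) * (-1 : ℂ) ^ (N + 1) /
          (poch (1 + a - b + 2) (N + 1) * (Nat.factorial (N + 1) : ℂ)) := by
      rw [kummerTerm, e, ← ha2]
      ring
    rw [hk, kummerTerm, hcc']
    rw [poch_succ_left a, poch_succ_left b, poch_succ (b + 1), poch_succ (1 + a - b + 2),
      poch_succ (a + 1), Nat.factorial_succ, pow_succ]
    push_cast
    field_simp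
    ring

lemma tsum_kummerTerm_add_two {a b : ℂ} (hb : b.re < 0) (h1 : ∀ m : ℕ, 1 + a - b ≠ -(m : ℂ)) :
    (1 + a) * (2 + a - 2 * b) * ∑' k, kummerTerm (a + 2) b k =
      (1 + a - b) * (1 + a - b + 1) * ∑' k, kummerTerm a b k := by
  have h1' : ∀ m : ℕ, 1 + a - b + 2 ≠ -(m : ℂ) := by simpa using ne_neg_natCast_add h1 2
  have h1'' : ∀ m : ℕ, 1 + (a + 2) - b ≠ -(m : ℂ) := by
    rwa [show 1 + (a + 2) - b = 1 + a - b + 2 by ring]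
  have hs := (summable_norm_kummerTerm hb h1).of_norm.hasSum.tendsto_sum_nat.comp
    (tendsto_add_atTop_nat 1)
  have hs' := (summable_norm_kummerTerm hb h1'').of_norm.hasSum.tendsto_sum_nat.comp
    (tendsto_add_atTop_nat 1)
  have hre : (a + 1 + (b + 1) - (1 + a - b + 2) - 1).re < 0 := by
    simp only [sub_re, add_re, one_re, re_ofNat]
    linarith
  have h0 := (tendsto_poch_mul_poch_div_zero h1' hre).const_mul (b * (1 - b))
  have hR := (hs.const_mul ((1 + a - b) * (1 + a - b + 1))).add h0
  rw [mul_zero, add_zero] at hR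
  refine tendsto_nhds_unique (hs'.const_mul _) (hR.congr fun N => ?_)
  simp only [Function.comp_apply]
  rw [sum_kummerTerm_add_two h1]
  ring

/-- The iterated contiguous relation in `a`. -/
lemma tsum_kummerTerm_add_two_mul {a b : ℂ} (hb : b.re < 0)
    (h1 : ∀ m : ℕ, 1 + a - b ≠ -(m : ℂ)) (n : ℕ) :
    poch (1 + a) (2 * n) * poch (1 + a / 2 - b) n * ∑' k, kummerTerm (a + 2 * n) b k =
      poch (1 + a / 2) n * poch (1 + a - b) (2 * n) * ∑' k, kummerTerm a b k := by
  induction n with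
  | zero => simp [poch_zero]
  | succ n ih =>
    have h1' : ∀ m : ℕ, 1 + (a + 2 * n) - b ≠ -(m : ℂ) := by
      have := ne_neg_natCast_add h1 (2 * n)
      push_cast at this
      rwa [show 1 + (a + 2 * n) - b = 1 + a - b + 2 * n by ring]
    have h := tsum_kummerTerm_add_two hb h1'
    rw [show a + 2 * ((n + 1 : ℕ) : ℂ) = a + 2 * n + 2 by push_cast; ring,
      show 2 * (n + 1) = 2 * n + 1 + 1 by ring]
    simp only [poch_succ]
    push_cast
    linear_combination (1 + a / 2 + n) * (1 + a - b + 2 * n) * (1 + a - b + (2 * n + 1)) * ih +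
      poch (1 + a) (2 * n) * poch (1 + a / 2 - b) n * (1 + a / 2 + n) * h

lemma norm_poch_le_norm_poch {x y : ℂ} (h : ∀ j : ℕ, ‖x + j‖ ≤ ‖y + j‖) (k : ℕ) :
    ‖poch x k‖ ≤ ‖poch y k‖ := by
  simp only [poch_eq_prod, norm_prod]
  exact prod_le_prod (fun _ _ => norm_nonneg _) fun j _ => h j

lemma norm_le_norm_add {u d : ℂ} (h : 0 ≤ u.re * d.re + u.im * d.im) : ‖u‖ ≤ ‖u + d‖ := by
  rw [← sq_le_sq₀ (norm_nonneg _) (norm_nonneg _), ← normSq_eq_norm_sq, ← normSq_eq_norm_sq,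
    normSq_apply, normSq_apply, add_re, add_im]
  nlinarith [sq_nonneg d.re, sq_nonneg d.im]

lemma tendsto_kummerTerm (a b : ℂ) (k : ℕ) :
    Tendsto (fun n : ℕ => kummerTerm (a + 2 * n) b k) atTop
      (𝓝 (poch b k / (Nat.factorial k : ℂ) * (-1) ^ k)) := by
  have h : Tendsto (fun n : ℕ => poch (a + 2 * n) k / poch (1 + (a + 2 * n) - b) k) atTop
      (𝓝 (∏ _j ∈ range k, 1)) := by
    simp only [poch_eq_prod, ← prod_div_distrib]
    refine tendsto_finsetProd _ fun j _ => ?_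
    have := tendsto_add_mul_div_add_mul_atTop_nhds (a + j) (1 + a - b + j) 2
      (two_ne_zero (α := ℂ))
    rw [div_self two_ne_zero] at this
    refine this.congr fun n => ?_
    congr 1 <;> ring
  have h' := h.mul_const (poch b k / (Nat.factorial k : ℂ) * (-1) ^ k)
  rw [prod_const_one, one_mul] at h'
  refine h'.congr fun n => ?_
  rw [kummerTerm]
  ring

lemma tendsto_tsum_kummerTerm {a b : ℂ} (hb : b.re < 0) :
    Tendsto (fun n : ℕ => ∑' k, kummerTerm (a + 2 * n) b k) atTop (𝓝 (2 ^ (-b))) := by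
  rw [← tsum_poch_div_factorial hb]
  refine tendsto_tsum_of_dominated_convergence (summable_norm_poch_div_factorial hb)
    (tendsto_kummerTerm a b) ?_
  have hev : ∀ᶠ n : ℕ in atTop, |a.im * b.im| / (1 - b.re) + |a.re| ≤ n :=
    tendsto_natCast_atTop_atTop.eventually_ge_atTop _
  filter_upwards [hev] with n hn k
  have hle : ‖poch (a + 2 * n) k‖ ≤ ‖poch (1 + (a + 2 * n) - b) k‖ := by
    refine norm_poch_le_norm_poch (fun j => ?_) k
    rw [show 1 + (a + 2 * n) - b + j = (a + 2 * n + j) + (1 - b) by ring]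
    refine norm_le_norm_add ?_
    have hn' : |a.im * b.im| / (1 - b.re) ≤ n - |a.re| := by linarith
    rw [div_le_iff₀ (by linarith)] at hn'
    simp only [add_re, add_im, mul_re, mul_im, re_ofNat, im_ofNat, natCast_re, natCast_im,
      sub_re, sub_im, one_re, one_im]
    have h2 := le_abs_self (a.im * b.im)
    have h3 := neg_abs_le a.re
    have h4 : (0 : ℝ) ≤ (n + j + (a.re + |a.re|)) * (1 - b.re) :=
      mul_nonneg (add_nonneg (by positivity) (by linarith)) (by linarith)
    linarith
  calc ‖kummerTerm (a + 2 * n) b k‖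
      = ‖poch (a + 2 * n) k‖ / ‖poch (1 + (a + 2 * n) - b) k‖ *
          ‖poch b k / (Nat.factorial k : ℂ)‖ := by
        simp only [kummerTerm, norm_div, norm_mul, norm_pow, norm_neg, norm_one, one_pow, mul_one]
        ring
    _ ≤ 1 * ‖poch b k / (Nat.factorial k : ℂ)‖ := by
        gcongr
        exact div_le_one_of_le₀ hle (norm_nonneg _)
    _ = _ := one_mul _

lemma tendsto_poch_ratio {a b : ℂ} (h1 : ∀ m : ℕ, 1 + a - b ≠ -(m : ℂ))
    (h2 : ∀ m : ℕ, 1 + a / 2 ≠ -(m : ℂ)) :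
    Tendsto (fun n : ℕ => poch (1 + a) (2 * n) * poch (1 + a / 2 - b) n /
        (poch (1 + a / 2) n * poch (1 + a - b) (2 * n))) atTop
      (𝓝 (Gamma (1 + a / 2) * Gamma (1 + a - b) /
        (Gamma (1 + a) * Gamma (1 + a / 2 - b)) * 2 ^ b)) := by
  have hd : Tendsto (fun n : ℕ => 2 * n) atTop atTop :=
    tendsto_id.const_mul_atTop' two_pos
  have h := ((((tendsto_poch_div (1 + a)).comp hd).mul (tendsto_poch_div (1 + a / 2 - b))).div
    ((tendsto_poch_div (1 + a / 2)).mul ((tendsto_poch_div (1 + a - b)).comp hd))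
    (mul_ne_zero (inv_ne_zero (Gamma_ne_zero h2))
      (inv_ne_zero (Gamma_ne_zero h1)))).mul_const ((2 : ℂ) ^ b)
  have e : Gamma (1 + a / 2) * Gamma (1 + a - b) / (Gamma (1 + a) * Gamma (1 + a / 2 - b)) =
      (Gamma (1 + a))⁻¹ * (Gamma (1 + a / 2 - b))⁻¹ /
        ((Gamma (1 + a / 2))⁻¹ * (Gamma (1 + a - b))⁻¹) := by
    rw [← mul_inv, ← mul_inv, inv_div_inv]
  rw [e]
  refine h.congr' ?_
  filter_upwards [eventually_ne_atTop 0] with n hn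
  have hn' : (n : ℂ) ≠ 0 := Nat.cast_ne_zero.mpr hn
  have hf (m : ℕ) : (Nat.factorial m : ℂ) ≠ 0 := Nat.cast_ne_zero.mpr m.factorial_ne_zero
  have hp (w : ℂ) : (n : ℂ) ^ w ≠ 0 := by simp [cpow_eq_zero_iff, hn']
  have hp2 (w : ℂ) : (2 : ℂ) ^ w ≠ 0 := by simp [cpow_eq_zero_iff]
  have hpow (w : ℂ) : ((2 * n : ℕ) : ℂ) ^ w = 2 ^ w * (n : ℂ) ^ w := by
    rw [Nat.cast_mul, natCast_mul_natCast_cpow, Nat.cast_ofNat]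
  have e1 : 1 + a - 1 = a := by ring
  have e2 : 1 + a / 2 - b - 1 = a / 2 - b := by ring
  have e3 : 1 + a / 2 - 1 = a / 2 := by ring
  have e4 : 1 + a - b - 1 = a - b := by ring
  have hf2 := hf (2 * n)
  have hf1 := hf n
  have ha := hp a
  have hb' := hp b
  have ha2 := hp (a / 2)
  have hta := hp2 a
  have htb := hp2 b
  have hp1 := poch_ne_zero h1 (2 * n)
  have hp2' := poch_ne_zero h2 n
  simp only [Pi.div_apply, Function.comp_apply, hpow, e1, e2, e3, e4, cpow_sub _ _ hn',
    cpow_sub _ _ (two_ne_zero (α := ℂ))]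
  field_simp

lemma tsum_kummerTerm {a b : ℂ} (hb : b.re < 0) (h1 : ∀ m : ℕ, 1 + a - b ≠ -(m : ℂ))
    (h2 : ∀ m : ℕ, 1 + a / 2 ≠ -(m : ℂ)) :
    ∑' k, kummerTerm a b k = Gamma (1 + a / 2) * Gamma (1 + a - b) /
      (Gamma (1 + a) * Gamma (1 + a / 2 - b)) := by
  have h := (tendsto_poch_ratio h1 h2).mul (tendsto_tsum_kummerTerm (a := a) hb)
  rw [mul_assoc, ← cpow_add _ _ two_ne_zero, add_neg_cancel, cpow_zero, mul_one] at h
  refine tendsto_nhds_unique (tendsto_const_nhds.congr fun n => ?_) h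
  have hd := mul_ne_zero (poch_ne_zero h2 n) (poch_ne_zero h1 (2 * n))
  rw [div_mul_eq_mul_div, eq_div_iff hd, tsum_kummerTerm_add_two_mul hb h1]
  ring

/-- Kummer's theorem: for `Re b < 1` and no nonpositive-integer degeneracies,
`∑_{k} (a)_k (b)_k (-1)^k / ((1+a-b)_k k!) = Γ(1+a/2) Γ(1+a-b) / (Γ(1+a) Γ(1+a/2-b))`,
where convergence is convergence of the partial sums. -/
theorem kummer_theorem (a b : ℂ) (hb : b.re < 1)
    (h1 : ∀ m : ℕ, 1 + a - b ≠ -(m : ℂ))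
    (h2 : ∀ m : ℕ, 1 + a / 2 ≠ -(m : ℂ))
    (h3 : ∀ m : ℕ, 1 + a ≠ -(m : ℂ))
    (h4 : ∀ m : ℕ, 1 + a / 2 - b ≠ -(m : ℂ)) :
    Tendsto (fun N : ℕ => ∑ k ∈ range N,
        poch a k * poch b k * (-1 : ℂ) ^ k /
          (poch (1 + a - b) k * (Nat.factorial k : ℂ)))
      atTop
      (𝓝 (Gamma (1 + a / 2) * Gamma (1 + a - b) /
        (Gamma (1 + a) * Gamma (1 + a / 2 - b)))) := by
  have hc : 1 + a - b ≠ 0 := by simpa using h1 0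
  have hc2 : 1 + a / 2 - b ≠ 0 := by simpa using h4 0
  have h1' : ∀ m : ℕ, 1 + a - b + 1 ≠ -(m : ℂ) := by simpa using ne_neg_natCast_add h1 1
  have h1'' : ∀ m : ℕ, 1 + a - (b - 1) ≠ -(m : ℂ) := by
    rwa [show 1 + a - (b - 1) = 1 + a - b + 1 by ring]
  have hb' : (b - 1).re < 0 := by
    rw [sub_re, one_re]
    linarith
  have hre : (a + 1 + b - (1 + a - b + 1) - 1).re < 0 := by
    simp only [sub_re, add_re, one_re]
    linarith
  have hs := (summable_norm_kummerTerm hb' h1'').of_norm.hasSum.tendsto_sum_nat.comp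
    (tendsto_add_atTop_nat 1)
  have h := ((hs.const_mul (2 + a - 2 * b)).add
    ((tendsto_poch_mul_poch_div_zero h1' hre).const_mul a)).const_mul (2 * (1 + a - b))⁻¹
  have hG : (2 * (1 + a - b))⁻¹ * ((2 + a - 2 * b) * ∑' k, kummerTerm a (b - 1) k + a * 0) =
      Gamma (1 + a / 2) * Gamma (1 + a - b) / (Gamma (1 + a) * Gamma (1 + a / 2 - b)) := by
    rw [tsum_kummerTerm hb' h1'' h2, show 1 + a - (b - 1) = 1 + a - b + 1 by ring,
      show 1 + a / 2 - (b - 1) = 1 + a / 2 - b + 1 by ring, Gamma_add_one _ hc,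
      Gamma_add_one _ hc2, show 2 + a - 2 * b = 2 * (1 + a / 2 - b) by ring]
    have hg3 := Gamma_ne_zero h3
    have hg4 := Gamma_ne_zero h4
    generalize 1 + a / 2 - b = d at *
    field_simp
    ring
  rw [hG] at h
  refine (tendsto_add_atTop_iff_nat 1).mp (h.congr fun N => ?_)
  rw [inv_mul_eq_iff_eq_mul₀ (mul_ne_zero two_ne_zero hc)]
  change _ = 2 * (1 + a - b) * ∑ k ∈ range (N + 1), kummerTerm a b k
  rw [sum_kummerTerm_sub_one h1, Function.comp_apply]
  ring
end

section
/- Dixon's ₄F₃(−1) theorem: Let a, b, c be complex numbers such that a/2, 1+a−b, 1+a−c are not nonpositive integers or zero, the series below converges, and 1+a, 1+a−b−c are not nonpositive integers. Then ∑_{k=0}^∞ (a)_k (1+a/2)_k (b)_k (c)_k (−1)^k / ((a/2)_k (1+a−b)_k (1+a−c)_k k!) = Γ(1+a−b) Γ(1+a−c) / (Γ(1+a) Γ(1+a−b−c)). -/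
open Complex Finset Filter Topology

/-- The hypergeometric term `(-1)^k (a)_k (b)_k (c)_k / ((1+a-b)_k (1+a-c)_k k!)`. -/
noncomputable def wellPoisedTerm (a b c : ℂ) (k : ℕ) : ℂ :=
  ∏ j ∈ range k, -((a + j) * (b + j) * (c + j) / ((1 + a - b + j) * (1 + a - c + j) * (j + 1)))

lemma wellPoisedTerm_succ (a b c : ℂ) (k : ℕ) :
    wellPoisedTerm a b c (k + 1) = wellPoisedTerm a b c k *
      -((a + k) * (b + k) * (c + k) / ((1 + a - b + k) * (1 + a - c + k) * (k + 1))) :=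
  prod_range_succ _ _

lemma poch_one_add_div_poch {x : ℂ} (hx : ∀ m : ℕ, x ≠ -(m : ℂ)) (k : ℕ) :
    poch (1 + x) k / poch x k = (x + k) / x := by
  have hx' : ∀ m : ℕ, x + m ≠ 0 := fun m h => hx m (eq_neg_of_add_eq_zero_left h)
  have hx0 : x ≠ 0 := by simpa using hx' 0
  simp only [poch_eq_prod]
  induction k with
  | zero => simp [hx0]
  | succ k ih =>
    rw [prod_range_succ, prod_range_succ, mul_div_mul_comm, ih]
    have := hx' k
    push_cast
    field_simp
    ring

lemma veryWellPoised_summand_eq {a : ℂ} (b c : ℂ) (h1 : ∀ m : ℕ, a / 2 ≠ -(m : ℂ)) (k : ℕ) :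
    poch a k * poch (1 + a / 2) k * poch b k * poch c k * (-1 : ℂ) ^ k /
      (poch (a / 2) k * poch (1 + a - b) k * poch (1 + a - c) k * (Nat.factorial k : ℂ)) =
    wellPoisedTerm a b c k * ((a + 2 * k) / a) := by
  have ha : a ≠ 0 := by
    rintro rfl
    exact h1 0 (by simp)
  have hterm : wellPoisedTerm a b c k = poch a k * poch b k * poch c k * (-1 : ℂ) ^ k /
      (poch (1 + a - b) k * poch (1 + a - c) k * (Nat.factorial k : ℂ)) := by
    induction k with
    | zero => simp [wellPoisedTerm, poch]
    | succ k ih =>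
      rw [wellPoisedTerm_succ, ih]
      simp only [poch_eq_prod, prod_range_succ, Nat.factorial_succ, pow_succ]
      push_cast
      rw [← neg_div, div_mul_div_comm]
      congr 1 <;> ring
  have hquot : (a + 2 * k) / a = poch (1 + a / 2) k / poch (a / 2) k := by
    rw [poch_one_add_div_poch h1]
    field_simp
  rw [hterm, hquot, div_mul_div_comm]
  congr 1 <;> ring

lemma wellPoisedTerm_add_one {a b c : ℂ} (ha : a ≠ 0)
    (hb : ∀ m : ℕ, 1 + a - b + m ≠ 0) (hc : ∀ m : ℕ, 1 + a - c + m ≠ 0) (k : ℕ) :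
    wellPoisedTerm (a + 1) b c k = wellPoisedTerm a b c k *
      ((a + k) * (1 + a - b) * (1 + a - c) / (a * (1 + a - b + k) * (1 + a - c + k))) := by
  have hb0 : 1 + a - b ≠ 0 := by simpa using hb 0
  have hc0 : 1 + a - c ≠ 0 := by simpa using hc 0
  induction k with
  | zero => simp [wellPoisedTerm]; field_simp
  | succ k ih =>
    rw [wellPoisedTerm_succ, wellPoisedTerm_succ, ih]
    have e1 := hb k
    have e2 := hc k
    have e3 := hb (k + 1)
    have e4 := hc (k + 1)
    have e5 : (k : ℂ) + 1 ≠ 0 := Nat.cast_add_one_ne_zero k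
    have r1 : 1 + (a + 1) - b + k = 1 + a - b + (k + 1 : ℕ) := by push_cast; ring
    have r2 : 1 + (a + 1) - c + k = 1 + a - c + (k + 1 : ℕ) := by push_cast; ring
    rw [r1, r2]
    have r3 : a + 1 + k = a + (k + 1 : ℕ) := by push_cast; ring
    rw [r3]
    generalize 1 + a - b + (k + 1 : ℕ) = u at *
    generalize 1 + a - c + (k + 1 : ℕ) = v at *
    field_simp

/-- The ratio of Dixon's closed form at `a` and at `a + 1`. -/
noncomputable def dixonRatio (a b c : ℂ) : ℂ :=
  (1 + a) * (1 + a - b - c) / ((1 + a - b) * (1 + a - c))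

lemma sum_veryWellPoised_eq {a b c : ℂ} (ha : a ≠ 0) (ha1 : a + 1 ≠ 0)
    (hb : ∀ m : ℕ, 1 + a - b + m ≠ 0) (hc : ∀ m : ℕ, 1 + a - c + m ≠ 0) (N : ℕ) :
    ∑ k ∈ range N, wellPoisedTerm a b c k * ((a + 2 * k) / a) =
      dixonRatio a b c *
        ∑ k ∈ range N, wellPoisedTerm (a + 1) b c k * ((a + 1 + 2 * k) / (a + 1)) -
      N / a * wellPoisedTerm a b c N := by
  have hb0 : 1 + a - b ≠ 0 := by simpa using hb 0
  have hc0 : 1 + a - c ≠ 0 := by simpa using hc 0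
  induction N with
  | zero => simp
  | succ k ih =>
    rw [sum_range_succ, sum_range_succ, ih, wellPoisedTerm_add_one ha hb hc, wellPoisedTerm_succ,
      mul_add, dixonRatio]
    have e1 := hb k
    have e2 := hc k
    have e5 : (k : ℂ) + 1 ≠ 0 := Nat.cast_add_one_ne_zero k
    have ha1' : 1 + a ≠ 0 := by rwa [add_comm]
    have key : (a + 2 * k) / a = (1 + a) * (1 + a - b - c) / ((1 + a - b) * (1 + a - c)) *
        (((a + k) * (1 + a - b) * (1 + a - c) / (a * (1 + a - b + k) * (1 + a - c + k))) *
          ((a + 1 + 2 * k) / (1 + a))) + k / a + ((k + 1 : ℕ) : ℂ) / a *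
        ((a + k) * (b + k) * (c + k) / ((1 + a - b + k) * (1 + a - c + k) * (k + 1))) := by
      push_cast
      field_simp
      ring
    rw [key, add_comm a 1]
    ring

lemma norm_wellPoisedTerm_le {a b c : ℂ} {B : ℝ} (hB : 0 ≤ B) (ha : ‖a‖ ≤ B) (hb : ‖b‖ ≤ B)
    (hc : ‖c‖ ≤ B) {n : ℕ} (hn : 8 * (B + 1) ^ 2 + 5 * B ≤ n) (k : ℕ) :
    ‖wellPoisedTerm (a + n) b c k‖ ≤ 1 / ((k : ℝ) + 1) ^ 3 := by
  induction k with
  | zero => simp [wellPoisedTerm]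
  | succ k ih =>
    rw [wellPoisedTerm_succ, norm_mul, norm_neg, norm_div, norm_mul, norm_mul, norm_mul, norm_mul]
    set y : ℝ := k + 1 with hy
    have hy1 : 1 ≤ y := by simp [hy]
    set v : ℝ := n - 2 * B with hv
    have hvK : 8 * (B + 1) ^ 2 + 3 * B ≤ v := by linarith
    have hv0 : 0 < v := by nlinarith
    have n1 : ‖a + n + k‖ ≤ v + y + 3 * B := by
      have : ‖a + n + k‖ ≤ ‖a‖ + ‖(n : ℂ)‖ + ‖(k : ℂ)‖ := norm_add₃_le
      simp only [Complex.norm_natCast] at this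
      linarith
    have n2 : ∀ z : ℂ, ‖z‖ ≤ B → ‖z + k‖ ≤ y + B := fun z hz => by
      have := norm_add_le z k
      simp only [Complex.norm_natCast] at this
      linarith
    have n3 : ∀ z : ℂ, ‖z‖ ≤ B → v + y ≤ ‖1 + (a + n) - z + k‖ := fun z hz => by
      have h : ‖((1 + n + k : ℕ) : ℂ)‖ ≤ ‖1 + (a + n) - z + k‖ + ‖a‖ + ‖z‖ := by
        have e : ((1 + n + k : ℕ) : ℂ) = (1 + (a + n) - z + k) - a + z := by push_cast; ring
        rw [e]
        exact (norm_add_le _ _).trans (by gcongr; exact norm_sub_le _ _)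
      rw [Complex.norm_natCast] at h
      push_cast at h
      linarith
    have n4 : ‖(k : ℂ) + 1‖ = y := by
      rw [← Nat.cast_add_one, Complex.norm_natCast]; simp [hy]
    rw [n4]
    have step : ‖a + n + k‖ * ‖b + k‖ * ‖c + k‖ /
        (‖1 + (a + n) - b + k‖ * ‖1 + (a + n) - c + k‖ * y) ≤
        (v + y + 3 * B) * (y + B) * (y + B) / ((v + y) * (v + y) * y) := by
      gcongr
      exacts [n2 b hb, n2 c hc, n3 b hb, n3 c hc]
    have poly : (y + B) ^ 2 * (y + 1) ^ 3 ≤ y ^ 4 * (y + 8 * (B + 1) ^ 2) := by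
      obtain ⟨w, hw, hyw⟩ : ∃ w : ℝ, 0 ≤ w ∧ y = 1 + w := ⟨y - 1, by linarith, by ring⟩
      rw [hyw]
      rw [← sub_nonneg]
      ring_nf
      positivity
    have quad : (v + y + 3 * B) * (y + 8 * (B + 1) ^ 2) ≤ (v + y) ^ 2 := by
      generalize 8 * (B + 1) ^ 2 = K at *
      nlinarith [mul_le_mul_of_nonneg_left hvK hv0.le,
        mul_le_mul_of_nonneg_left hvK (by linarith : 0 ≤ y),
        mul_nonneg hB (by linarith : 0 ≤ v - 3 * B - K), mul_nonneg hB hB]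
    have bound : (v + y + 3 * B) * (y + B) * (y + B) / ((v + y) * (v + y) * y) ≤
        y ^ 3 / (y + 1) ^ 3 := by
      rw [div_le_div_iff₀ (by positivity) (by positivity)]
      calc (v + y + 3 * B) * (y + B) * (y + B) * (y + 1) ^ 3
          = (v + y + 3 * B) * ((y + B) ^ 2 * (y + 1) ^ 3) := by ring
        _ ≤ (v + y + 3 * B) * (y ^ 4 * (y + 8 * (B + 1) ^ 2)) := by gcongr
        _ = y ^ 4 * ((v + y + 3 * B) * (y + 8 * (B + 1) ^ 2)) := by ring
        _ ≤ y ^ 4 * (v + y) ^ 2 := by gcongr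
        _ = y ^ 3 * ((v + y) * (v + y) * y) := by ring
    calc _ ≤ 1 / y ^ 3 * (y ^ 3 / (y + 1) ^ 3) := by
          exact mul_le_mul ih (step.trans bound) (by positivity) (by positivity)
      _ = 1 / (((k + 1 : ℕ) : ℝ) + 1) ^ 3 := by
          push_cast
          rw [← hy]
          field_simp

lemma tendsto_add_natCast_inv (x : ℂ) : Tendsto (fun n : ℕ => (x + n)⁻¹) atTop (𝓝 0) :=
  tendsto_inv₀_cobounded.comp
    ((tendsto_const_add_cobounded x).comp tendsto_natCast_atTop_cobounded)

lemma tendsto_add_natCast_div_add_natCast (x y : ℂ) :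
    Tendsto (fun n : ℕ => (x + n) / (y + n)) atTop (𝓝 1) := by
  have h := ((tendsto_add_natCast_inv y).const_mul (x - y)).const_add 1
  rw [mul_zero, add_zero] at h
  refine h.congr' ?_
  have hne : ∀ᶠ n : ℕ in atTop, y + n ≠ 0 := by
    have : Tendsto (fun n : ℕ => y + n) atTop (Bornology.cobounded ℂ) :=
      (tendsto_const_add_cobounded y).comp tendsto_natCast_atTop_cobounded
    exact this.eventually (Bornology.eventually_ne_cobounded 0)
  filter_upwards [hne] with n hn
  field_simp
  ring

lemma tendsto_sum_veryWellPoised_add_one {a b c S : ℂ} (ha : ∀ m : ℕ, a + m ≠ 0)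
    (hb : ∀ m : ℕ, 1 + a - b + m ≠ 0) (hc : ∀ m : ℕ, 1 + a - c + m ≠ 0)
    (hbc : 1 + a - b - c ≠ 0)
    (hS : Tendsto (fun N => ∑ k ∈ range N, wellPoisedTerm a b c k * ((a + 2 * k) / a))
      atTop (𝓝 S)) :
    Tendsto (fun N => ∑ k ∈ range N, wellPoisedTerm (a + 1) b c k * ((a + 1 + 2 * k) / (a + 1)))
      atTop (𝓝 (S / dixonRatio a b c)) := by
  have ha0 : a ≠ 0 := by simpa using ha 0
  have ha1 : a + 1 ≠ 0 := by simpa using ha 1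
  have hR : dixonRatio a b c ≠ 0 := by
    have hb0 : 1 + a - b ≠ 0 := by simpa using hb 0
    have hc0 : 1 + a - c ≠ 0 := by simpa using hc 0
    rw [add_comm] at ha1
    exact div_ne_zero (mul_ne_zero ha1 hbc) (mul_ne_zero hb0 hc0)
  have hterm : Tendsto (fun N : ℕ => wellPoisedTerm a b c N * ((a + 2 * N) / a)) atTop (𝓝 0) := by
    have h := ((tendsto_add_atTop_iff_nat 1).2 hS).sub hS
    simpa [sum_range_succ] using h
  have hbdry : Tendsto (fun N : ℕ => N / a * wellPoisedTerm a b c N) atTop (𝓝 0) := by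
    have h := hterm.mul ((tendsto_add_natCast_div_add_natCast 0 (a / 2)).div_const 2)
    rw [zero_mul] at h
    refine h.congr fun N => ?_
    have h2 : a + 2 * N ≠ 0 := by simpa using ha (2 * N)
    have h3 : a / 2 + N ≠ 0 := fun h => h2 (by linear_combination 2 * h)
    field_simp
    ring
  have h := (hS.add hbdry).div_const (dixonRatio a b c)
  rw [add_zero] at h
  refine h.congr fun N => ?_
  rw [sum_veryWellPoised_eq ha0 ha1 hb hc N, sub_add_cancel, mul_div_cancel_left₀ _ hR]

lemma tendsto_sum_veryWellPoised_add_natCast {a b c S : ℂ} (ha : ∀ m : ℕ, a + m ≠ 0)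
    (hb : ∀ m : ℕ, 1 + a - b + m ≠ 0) (hc : ∀ m : ℕ, 1 + a - c + m ≠ 0)
    (hbc : ∀ m : ℕ, 1 + a - b - c + m ≠ 0)
    (hS : Tendsto (fun N => ∑ k ∈ range N, wellPoisedTerm a b c k * ((a + 2 * k) / a))
      atTop (𝓝 S)) (n : ℕ) :
    Tendsto (fun N => ∑ k ∈ range N,
      wellPoisedTerm (a + n) b c k * ((a + n + 2 * k) / (a + n)))
      atTop (𝓝 (S / ∏ j ∈ range n, dixonRatio (a + j) b c)) := by
  induction n with
  | zero => simpa using hS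
  | succ n ih =>
    have h := tendsto_sum_veryWellPoised_add_one
      (fun m h => ha (n + m) (by push_cast; linear_combination h))
      (fun m h => hb (n + m) (by push_cast; linear_combination h))
      (fun m h => hc (n + m) (by push_cast; linear_combination h))
      (fun h => hbc n (by linear_combination h)) ih
    rw [prod_range_succ, ← div_div]
    simpa only [Nat.cast_add_one, add_assoc] using h

lemma tendsto_wellPoisedTerm_add_natCast (a b c : ℂ) (k : ℕ) :
    Tendsto (fun n : ℕ => wellPoisedTerm (a + n) b c k) atTop (𝓝 (if k = 0 then 1 else 0)) := by
  have hfactor : ∀ j : ℕ, Tendsto (fun n : ℕ => -((a + n + j) * (b + j) * (c + j) /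
      ((1 + (a + n) - b + j) * (1 + (a + n) - c + j) * (j + 1)))) atTop (𝓝 0) := fun j => by
    have h := (((tendsto_add_natCast_div_add_natCast (a + j) (1 + a - b + j)).mul
      (tendsto_add_natCast_inv (1 + a - c + j))).mul_const ((b + j) * (c + j) / (j + 1))).neg
    rw [mul_zero, zero_mul, neg_zero] at h
    refine h.congr fun n => ?_
    rw [show 1 + (a + n) - b + j = 1 + a - b + j + n by ring,
      show 1 + (a + n) - c + j = 1 + a - c + j + n by ring,
      show a + n + j = a + j + n by ring]
    simp only [div_eq_mul_inv, mul_inv]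
    ring
  have h := tendsto_finsetProd (range k) fun j _ => hfactor j
  rwa [prod_const, card_range, zero_pow_eq] at h

lemma eventually_norm_veryWellPoised_le (a b c : ℂ) :
    ∀ᶠ n : ℕ in atTop, ∀ k : ℕ,
      ‖wellPoisedTerm (a + n) b c k * ((a + n + 2 * k) / (a + n))‖ ≤
        2 * (1 / ((k + 1 : ℕ) : ℝ) ^ 2) := by
  set B : ℝ := ‖a‖ + ‖b‖ + ‖c‖ with hB
  have hna := norm_nonneg a
  have hnb := norm_nonneg b
  have hnc := norm_nonneg c
  filter_upwards [eventually_ge_atTop ⌈8 * (B + 1) ^ 2 + 5 * B⌉₊] with n hn k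
  have hn' : 8 * (B + 1) ^ 2 + 5 * B ≤ n := Nat.ceil_le.1 hn
  have hB0 : 0 ≤ B := by positivity
  have hterm := norm_wellPoisedTerm_le hB0 (by linarith : ‖a‖ ≤ B) (by linarith : ‖b‖ ≤ B)
    (by linarith : ‖c‖ ≤ B) hn' k
  have hA : 1 ≤ ‖a + n‖ := by
    have h := norm_sub_le (a + n) a
    rw [add_sub_cancel_left, Complex.norm_natCast] at h
    nlinarith
  have hquot : ‖(a + n + 2 * k) / (a + n)‖ ≤ 2 * (k + 1) := by
    rw [norm_div, div_le_iff₀ (by linarith)]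
    have h := norm_add_le (a + n) (2 * k)
    rw [norm_mul, Complex.norm_natCast, Complex.norm_ofNat] at h
    nlinarith [mul_le_mul_of_nonneg_left hA (Nat.cast_nonneg (α := ℝ) k)]
  rw [norm_mul]
  refine (mul_le_mul hterm hquot (norm_nonneg _) (by positivity)).trans_eq ?_
  push_cast
  field_simp

lemma summable_two_mul_one_div_succ_sq :
    Summable fun k : ℕ => 2 * (1 / ((k + 1 : ℕ) : ℝ) ^ 2) :=
  ((summable_nat_add_iff 1).2 (Real.summable_one_div_nat_pow.2 one_lt_two)).mul_left 2

lemma tendsto_tsum_veryWellPoised (a b c : ℂ) :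
    Tendsto (fun n : ℕ => ∑' k : ℕ,
      wellPoisedTerm (a + n) b c k * ((a + n + 2 * k) / (a + n))) atTop (𝓝 1) := by
  rw [← tsum_ite_eq (0 : ℕ) fun _ => (1 : ℂ)]
  refine tendsto_tsum_of_dominated_convergence summable_two_mul_one_div_succ_sq (fun k => ?_)
    (eventually_norm_veryWellPoised_le a b c)
  have h := (tendsto_wellPoisedTerm_add_natCast a b c k).mul
    (tendsto_add_natCast_div_add_natCast (a + 2 * k) a)
  rw [mul_one] at h
  refine h.congr fun n => ?_
  rw [add_right_comm]

lemma GammaSeq_mul_div_eq_prod_dixonRatio (a b c : ℂ) {n : ℕ} (hn : n ≠ 0) :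
    GammaSeq (1 + a - b) n * GammaSeq (1 + a - c) n /
      (GammaSeq (1 + a) n * GammaSeq (1 + a - b - c) n) =
    ∏ j ∈ range (n + 1), dixonRatio (a + j) b c := by
  have hn' : (n : ℂ) ≠ 0 := Nat.cast_ne_zero.2 hn
  have hpow : (n : ℂ) ^ (1 + a - b) * (n : ℂ) ^ (1 + a - c) =
      (n : ℂ) ^ (1 + a) * (n : ℂ) ^ (1 + a - b - c) := by
    rw [← cpow_add _ _ hn', ← cpow_add _ _ hn']
    congr 1
    ring
  have hfact : (Nat.factorial n : ℂ) ≠ 0 := Nat.cast_ne_zero.2 n.factorial_ne_zero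
  have hp : (n : ℂ) ^ (1 + a) * (n : ℂ) ^ (1 + a - b - c) * (Nat.factorial n : ℂ) ^ 2 ≠ 0 := by
    simp [cpow_eq_zero_iff, hn', hfact]
  have hprod : ∏ j ∈ range (n + 1), dixonRatio (a + j) b c =
      (∏ j ∈ range (n + 1), (1 + a + j)) * (∏ j ∈ range (n + 1), (1 + a - b - c + j)) /
      ((∏ j ∈ range (n + 1), (1 + a - b + j)) * ∏ j ∈ range (n + 1), (1 + a - c + j)) := by
    rw [← prod_mul_distrib, ← prod_mul_distrib, ← prod_div_distrib]
    refine prod_congr rfl fun j _ => ?_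
    rw [dixonRatio]
    congr 2 <;> ring
  rw [hprod]
  simp only [GammaSeq]
  rw [div_mul_div_comm, div_mul_div_comm, div_div_div_eq]
  refine Eq.trans ?_ (mul_div_mul_left _ _ hp)
  congr 1
  · linear_combination (Nat.factorial n : ℂ) ^ 2 * (∏ j ∈ range (n + 1), (1 + a + j)) *
      (∏ j ∈ range (n + 1), (1 + a - b - c + j)) * hpow
  · ring

lemma tendsto_prod_dixonRatio {a b c : ℂ} (ha : ∀ m : ℕ, 1 + a ≠ -(m : ℂ))
    (hbc : ∀ m : ℕ, 1 + a - b - c ≠ -(m : ℂ)) :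
    Tendsto (fun n => ∏ j ∈ range n, dixonRatio (a + j) b c) atTop
      (𝓝 (Gamma (1 + a - b) * Gamma (1 + a - c) / (Gamma (1 + a) * Gamma (1 + a - b - c)))) := by
  refine (tendsto_add_atTop_iff_nat 1).1 ?_
  refine Tendsto.congr' ?_ (((GammaSeq_tendsto_Gamma (1 + a - b)).mul
    (GammaSeq_tendsto_Gamma (1 + a - c))).div ((GammaSeq_tendsto_Gamma (1 + a)).mul
    (GammaSeq_tendsto_Gamma (1 + a - b - c)))
    (mul_ne_zero (Gamma_ne_zero ha) (Gamma_ne_zero hbc)))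
  filter_upwards [eventually_ne_atTop 0] with n hn
  exact GammaSeq_mul_div_eq_prod_dixonRatio a b c hn

/-- Dixon's `₄F₃(-1)` theorem: assuming the series converges,
`₄F₃(a, 1+a/2, b, c; a/2, 1+a-b, 1+a-c; -1) = Γ(1+a-b) Γ(1+a-c) / (Γ(1+a) Γ(1+a-b-c))`. -/
theorem dixon_4F3_theorem (a b c : ℂ)
    (h1 : ∀ m : ℕ, a / 2 ≠ -(m : ℂ))
    (h2 : ∀ m : ℕ, 1 + a - b ≠ -(m : ℂ))
    (h3 : ∀ m : ℕ, 1 + a - c ≠ -(m : ℂ))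
    (h4 : ∀ m : ℕ, 1 + a ≠ -(m : ℂ))
    (h5 : ∀ m : ℕ, 1 + a - b - c ≠ -(m : ℂ))
    (hconv : ∃ S : ℂ, Tendsto (fun N : ℕ => ∑ k ∈ range N,
        poch a k * poch (1 + a / 2) k * poch b k * poch c k * (-1 : ℂ) ^ k /
          (poch (a / 2) k * poch (1 + a - b) k * poch (1 + a - c) k *
            (Nat.factorial k : ℂ)))
      atTop (𝓝 S)) :
    Tendsto (fun N : ℕ => ∑ k ∈ range N,
        poch a k * poch (1 + a / 2) k * poch b k * poch c k * (-1 : ℂ) ^ k /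
          (poch (a / 2) k * poch (1 + a - b) k * poch (1 + a - c) k *
            (Nat.factorial k : ℂ)))
      atTop
      (𝓝 (Gamma (1 + a - b) * Gamma (1 + a - c) /
        (Gamma (1 + a) * Gamma (1 + a - b - c)))) := by
  obtain ⟨S, hS⟩ := hconv
  suffices h : S = Gamma (1 + a - b) * Gamma (1 + a - c) /
      (Gamma (1 + a) * Gamma (1 + a - b - c)) by rwa [← h]
  simp only [veryWellPoised_summand_eq b c h1] at hS
  have nz : ∀ {x : ℂ}, (∀ m : ℕ, x ≠ -(m : ℂ)) → ∀ m : ℕ, x + m ≠ 0 :=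
    fun hx m h => hx m (eq_neg_of_add_eq_zero_left h)
  have ha : ∀ m : ℕ, a + m ≠ 0 := by
    rintro (_ | m) h
    · exact h1 0 (by simpa using h)
    · exact nz h4 m (by push_cast at h; linear_combination h)
  have hlim := tendsto_sum_veryWellPoised_add_natCast ha (nz h2) (nz h3) (nz h5) hS
  refine tendsto_nhds_unique (Tendsto.congr' ?_ tendsto_const_nhds)
    (by simpa using (tendsto_prod_dixonRatio h4 h5).mul (tendsto_tsum_veryWellPoised a b c))
  filter_upwards [eventually_norm_veryWellPoised_le a b c] with n hn
  have hsum := Summable.of_norm_bounded summable_two_mul_one_div_succ_sq hn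
  rw [tendsto_nhds_unique hsum.hasSum.tendsto_sum_nat (hlim n), mul_div_cancel₀]
  refine prod_ne_zero_iff.2 fun j _ => ?_
  rw [dixonRatio]
  refine div_ne_zero (mul_ne_zero ?_ ?_) (mul_ne_zero ?_ ?_) <;> intro h
  · exact nz h4 j (by linear_combination h)
  · exact nz h5 j (by linear_combination h)
  · exact nz h2 j (by linear_combination h)
  · exact nz h3 j (by linear_combination h)
end
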